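/- There exist δ₀ > 0 and C < ∞ with the following property. Let f : S² → ℝ³ be continuous with δ∞ := sup_{x∈S²} |f(x) − x| ≤ δ₀. For a ∈ ℝ³, R ∈ SO(3), and v ∈ ℝ³ with |v| < 1, define ℰ(a, R, v) := ∫_{S²} |f(R(φ_v(x))) + a − x|² dσ(x). If (a₀, R₀, v₀) is a global minimizer of ℰ, then |a₀| ≤ C δ∞ and ∫_{S²} |R₀(φ_{v₀}(x)) − x|² dσ(x) ≤ C² δ∞². -/

import Mathlib

open MeasureTheory RealInnerProductSpace Real

noncomputable section

abbrev E3 := EuclideanSpace ℝ (Fin 3)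

/-- The standard surface measure `σ` on `S² ⊂ ℝ³`, with `σ(S²) = 4π`. -/
def sphMeasure : Measure (Metric.sphere (0 : E3) 1) := volume.toSphere

/-- The Möbius transformation `φ_v(x) = ((1 − |v|²)x + 2(1 + v·x)v)/(1 + |v|² + 2 v·x)`. -/
def mob (v x : E3) : E3 :=
  (1 + ‖v‖ ^ 2 + 2 * ⟪v, x⟫)⁻¹ • ((1 - ‖v‖ ^ 2) • x + (2 * (1 + ⟪v, x⟫)) • v)

/-- The action of a `3 × 3` real matrix on `ℝ³`. -/
def matAct (R : Matrix (Fin 3) (Fin 3) ℝ) (x : E3) : E3 := Matrix.toEuclideanLin R x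

/-- The normalization functional `ℰ(a, R, v) = ∫_{S²} |f(R(φ_v(x))) + a − x|² dσ(x)`. -/
def En (f : E3 → E3) (a : E3) (R : Matrix (Fin 3) (Fin 3) ℝ) (v : E3) : ℝ :=
  ∫ x : Metric.sphere (0 : E3) 1, ‖f (matAct R (mob v x)) + a - (x : E3)‖ ^ 2 ∂sphMeasure

/-- The homeomorphism of the unit sphere induced by a linear isometry. -/
def sphereHomeomorph (L : E3 ≃ₗᵢ[ℝ] E3) :
    Metric.sphere (0 : E3) 1 ≃ₜ Metric.sphere (0 : E3) 1 where
  toFun x := ⟨L x, by simp⟩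
  invFun x := ⟨L.symm x, by simp⟩
  left_inv x := by simp
  right_inv x := by simp
  continuous_toFun := by fun_prop
  continuous_invFun := by fun_prop

instance : IsFiniteMeasure sphMeasure := by unfold sphMeasure; infer_instance

lemma sphMeasure_univ_pos : 0 < sphMeasure.real Set.univ := by
  have : NeZero sphMeasure := ⟨Measure.toSphere_ne_zero _⟩
  exact measureReal_univ_pos

open scoped Pointwise in
lemma measurePreserving_sphereHomeomorph (L : E3 ≃ₗᵢ[ℝ] E3) :
    MeasurePreserving (sphereHomeomorph L) sphMeasure sphMeasure := by
  refine ⟨(sphereHomeomorph L).measurable, ?_⟩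
  ext s hs
  have hpre := (sphereHomeomorph L).measurable hs
  rw [Measure.map_apply (sphereHomeomorph L).measurable hs, sphMeasure,
    Measure.toSphere_apply' _ hpre, Measure.toSphere_apply' _ hs]
  congr 1
  rw [← L.measurePreserving.measure_preimage_emb L.toHomeomorph.measurableEmbedding
    (Set.Ioo (0 : ℝ) 1 • (Subtype.val '' s))]
  congr 1
  ext y
  simp only [Set.mem_smul, Set.mem_image, Set.mem_preimage]
  constructor
  · rintro ⟨r, hr, _, ⟨x, hx, rfl⟩, rfl⟩
    exact ⟨r, hr, _, ⟨_, hx, rfl⟩, by simp [sphereHomeomorph]⟩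
  · rintro ⟨r, hr, _, ⟨x, hx, rfl⟩, hxy⟩
    refine ⟨r, hr, _, ⟨(sphereHomeomorph L).symm x, by simpa using hx, rfl⟩, L.injective ?_⟩
    rw [← hxy]
    simp [sphereHomeomorph]

lemma integral_sphere_comp_isometry (L : E3 ≃ₗᵢ[ℝ] E3) (F : E3 → ℝ) :
    ∫ x : Metric.sphere (0 : E3) 1, F (L x) ∂sphMeasure =
      ∫ x : Metric.sphere (0 : E3) 1, F x ∂sphMeasure :=
  (measurePreserving_sphereHomeomorph L).integral_comp
    (sphereHomeomorph L).measurableEmbedding fun x => F x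

lemma integrable_sphere {F : Metric.sphere (0 : E3) 1 → ℝ} (hF : Continuous F) :
    Integrable F sphMeasure :=
  hF.integrable_of_hasCompactSupport (HasCompactSupport.of_compactSpace F)

lemma integral_inner_sq_eq_of_norm_eq {a b : E3} (h : ‖a‖ = ‖b‖) :
    ∫ x : Metric.sphere (0 : E3) 1, ⟪a, (x : E3)⟫ ^ 2 ∂sphMeasure =
      ∫ x : Metric.sphere (0 : E3) 1, ⟪b, (x : E3)⟫ ^ 2 ∂sphMeasure := by
  let L : E3 ≃ₗᵢ[ℝ] E3 := (ℝ ∙ (a - b))ᗮ.reflection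
  have hL : L a = b := Submodule.reflection_sub h
  rw [← integral_sphere_comp_isometry L fun x => ⟪b, x⟫ ^ 2, ← hL]
  simp

lemma three_mul_integral_inner_sq (a : E3) :
    3 * ∫ x : Metric.sphere (0 : E3) 1, ⟪a, (x : E3)⟫ ^ 2 ∂sphMeasure =
      ‖a‖ ^ 2 * sphMeasure.real Set.univ := by
  have key (i : Fin 3) : ∫ x : Metric.sphere (0 : E3) 1, ⟪a, (x : E3)⟫ ^ 2 ∂sphMeasure =
      ∫ x : Metric.sphere (0 : E3) 1, ‖a‖ ^ 2 * (x : E3) i ^ 2 ∂sphMeasure := by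
    rw [integral_inner_sq_eq_of_norm_eq (b := EuclideanSpace.single i ‖a‖) (by simp)]
    simp [EuclideanSpace.inner_single_left, mul_pow]
  have hint (i : Fin 3) : Integrable
      (fun x : Metric.sphere (0 : E3) 1 => ‖a‖ ^ 2 * (x : E3) i ^ 2) sphMeasure :=
    integrable_sphere (by fun_prop)
  calc
    _ = ∑ i : Fin 3, ∫ x : Metric.sphere (0 : E3) 1, ‖a‖ ^ 2 * (x : E3) i ^ 2 ∂sphMeasure := by
      simp [← key]
    _ = ∫ _ : Metric.sphere (0 : E3) 1, ‖a‖ ^ 2 ∂sphMeasure := by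
      rw [← integral_finsetSum _ fun i _ => hint i]
      congr with x
      rw [← Finset.mul_sum, ← EuclideanSpace.real_norm_sq_eq, norm_eq_of_mem_sphere]
      simp
    _ = _ := by simp [mul_comm]

lemma inner_sq_le_of_norm_eq_one {a x : E3} (hx : ‖x‖ = 1) (ha : ‖a‖ ≤ 5) :
    ⟪a, x⟫ ^ 2 ≤ 18 * ((‖x - a‖ - 1) ^ 2 + (‖-x - a‖ - 1) ^ 2) := by
  have hP : ‖x - a‖ ^ 2 = 1 - 2 * ⟪a, x⟫ + ‖a‖ ^ 2 := by
    rw [norm_sub_sq_real, real_inner_comm, hx]; ring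
  have hQ : ‖-x - a‖ ^ 2 = 1 + 2 * ⟪a, x⟫ + ‖a‖ ^ 2 := by
    rw [norm_sub_sq_real, real_inner_comm, inner_neg_right, norm_neg, hx]; ring
  have hP' : ‖x - a‖ ≤ 6 := by linarith [norm_sub_le x a]
  have hQ' : ‖-x - a‖ ≤ 6 := by linarith [norm_sub_le (-x) a, norm_neg x]
  have hPn := norm_nonneg (x - a)
  have hQn := norm_nonneg (-x - a)
  generalize ‖x - a‖ = P at *
  generalize ‖-x - a‖ = Q at *
  have ht : 4 * ⟪a, x⟫ = (Q - P) * (Q + P) := by linear_combination hP - hQ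
  have hs : (Q + P) ^ 2 ≤ 144 := by nlinarith
  have h16 : 16 * ⟪a, x⟫ ^ 2 = (Q - P) ^ 2 * (Q + P) ^ 2 := by
    linear_combination (4 * ⟪a, x⟫ + (Q - P) * (Q + P)) * ht
  nlinarith [mul_le_mul_of_nonneg_left hs (sq_nonneg (Q - P)), sq_nonneg (P - 1 + (Q - 1))]

lemma norm_sq_mul_measure_le {a : E3} (ha : ‖a‖ ≤ 5) :
    ‖a‖ ^ 2 * sphMeasure.real Set.univ ≤
      108 * ∫ x : Metric.sphere (0 : E3) 1, (‖(x : E3) - a‖ - 1) ^ 2 ∂sphMeasure := by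
  have hint₁ : Integrable
      (fun x : Metric.sphere (0 : E3) 1 => (‖(x : E3) - a‖ - 1) ^ 2) sphMeasure :=
    integrable_sphere (by fun_prop)
  have hint₂ : Integrable
      (fun x : Metric.sphere (0 : E3) 1 => (‖-(x : E3) - a‖ - 1) ^ 2) sphMeasure :=
    integrable_sphere (by fun_prop)
  have hneg := integral_sphere_comp_isometry (LinearIsometryEquiv.neg ℝ)
    fun x => (‖x - a‖ - 1) ^ 2
  simp only [LinearIsometryEquiv.coe_neg] at hneg
  have hmono : ∫ x : Metric.sphere (0 : E3) 1, ⟪a, (x : E3)⟫ ^ 2 ∂sphMeasure ≤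
      ∫ x : Metric.sphere (0 : E3) 1,
        18 * ((‖(x : E3) - a‖ - 1) ^ 2 + (‖-(x : E3) - a‖ - 1) ^ 2) ∂sphMeasure :=
    integral_mono (integrable_sphere (by fun_prop)) ((hint₁.add hint₂).const_mul 18)
      fun x => inner_sq_le_of_norm_eq_one (norm_eq_of_mem_sphere x) ha
  rw [integral_const_mul, integral_add hint₁ hint₂, hneg] at hmono
  linarith [three_mul_integral_inner_sq a]

lemma mob_denom_pos {v x : E3} (hv : ‖v‖ < 1) (hx : ‖x‖ = 1) :
    0 < 1 + ‖v‖ ^ 2 + 2 * ⟪v, x⟫ := by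
  have h := abs_le.1 (abs_real_inner_le_norm v x)
  rw [hx] at h
  nlinarith [h.1]

lemma norm_mob {v x : E3} (hv : ‖v‖ < 1) (hx : ‖x‖ = 1) : ‖mob v x‖ = 1 := by
  have hD := mob_denom_pos hv hx
  have hnum : ‖(1 - ‖v‖ ^ 2) • x + (2 * (1 + ⟪v, x⟫)) • v‖ =
      1 + ‖v‖ ^ 2 + 2 * ⟪v, x⟫ := by
    rw [← sq_eq_sq₀ (norm_nonneg _) hD.le, norm_add_sq_real, norm_smul, norm_smul,
      real_inner_smul_left, real_inner_smul_right, mul_pow, mul_pow, hx, Real.norm_eq_abs,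
      Real.norm_eq_abs, sq_abs, sq_abs, real_inner_comm]
    ring
  rw [mob, norm_smul, hnum, norm_inv, Real.norm_of_nonneg hD.le, inv_mul_cancel₀ hD.ne']

lemma norm_matAct {R : Matrix (Fin 3) (Fin 3) ℝ}
    (hR : R ∈ Matrix.specialOrthogonalGroup (Fin 3) ℝ) (x : E3) : ‖matAct R x‖ = ‖x‖ := by
  have hR' : R.transpose * R = 1 :=
    (Matrix.mem_orthogonalGroup_iff' (Fin 3) ℝ).1 (Matrix.mem_specialOrthogonalGroup_iff.1 hR).1
  rw [← sq_eq_sq₀ (norm_nonneg _) (norm_nonneg _), ← real_inner_self_eq_norm_sq,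
    ← real_inner_self_eq_norm_sq, EuclideanSpace.inner_eq_star_dotProduct,
    EuclideanSpace.inner_eq_star_dotProduct, matAct, Matrix.ofLp_toLpLin]
  simp only [star_trivial, Matrix.toLin'_apply]
  rw [Matrix.dotProduct_mulVec, ← Matrix.mulVec_transpose, Matrix.mulVec_mulVec, hR',
    Matrix.one_mulVec]

lemma continuous_matAct (R : Matrix (Fin 3) (Fin 3) ℝ) : Continuous (matAct R) :=
  (Matrix.toEuclideanLin R).continuous_of_finiteDimensional

lemma continuous_mob {v : E3} (hv : ‖v‖ < 1) :
    Continuous fun x : Metric.sphere (0 : E3) 1 => mob v x := by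
  have hD : Continuous fun x : Metric.sphere (0 : E3) 1 => 1 + ‖v‖ ^ 2 + 2 * ⟪v, (x : E3)⟫ := by
    fun_prop
  exact (hD.inv₀ fun x => (mob_denom_pos hv (norm_eq_of_mem_sphere x)).ne').smul (by fun_prop)

lemma En_zero_one_zero (f : E3 → E3) :
    En f 0 1 0 = ∫ x : Metric.sphere (0 : E3) 1, ‖f x - (x : E3)‖ ^ 2 ∂sphMeasure := by
  simp [En, mob, matAct, Matrix.toEuclideanLin]

lemma En_zero_one_zero_le {f : E3 → E3} {δ : ℝ} (hf : ContinuousOn f (Metric.sphere (0 : E3) 1))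
    (hδ : ∀ x ∈ Metric.sphere (0 : E3) 1, ‖f x - x‖ ≤ δ) :
    En f 0 1 0 ≤ δ ^ 2 * sphMeasure.real Set.univ := by
  have hcont : Continuous fun x : Metric.sphere (0 : E3) 1 => f x :=
    continuousOn_iff_continuous_domRestrict.1 hf
  calc
    En f 0 1 0 ≤ ∫ _ : Metric.sphere (0 : E3) 1, δ ^ 2 ∂sphMeasure := by
      rw [En_zero_one_zero]
      exact integral_mono (integrable_sphere ((hcont.sub continuous_subtype_val).norm.pow 2))
        (integrable_const _) fun x => pow_le_pow_left₀ (norm_nonneg _) (hδ x x.2) 2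
    _ = δ ^ 2 * sphMeasure.real Set.univ := by simp [mul_comm]

lemma integral_le_of_le_affine {F G : Metric.sphere (0 : E3) 1 → ℝ} {c d : ℝ} (hF : Continuous F)
    (hG : Continuous G) (h : ∀ x, F x ≤ c * G x + d) :
    ∫ x, F x ∂sphMeasure ≤ c * ∫ x, G x ∂sphMeasure + d * sphMeasure.real Set.univ := by
  have hG' := (integrable_sphere hG).const_mul c
  refine (integral_mono (integrable_sphere hF) (hG'.add (integrable_const d)) h).trans_eq ?_
  rw [integral_add' hG' (integrable_const d), integral_const_mul]
  simp [mul_comm]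

/-- Stability of the identity among perturbed translates of maps from the sphere to itself. -/
lemma translation_and_displacement_bound {ψ g : Metric.sphere (0 : E3) 1 → E3} {a : E3} {δ : ℝ}
    (hψ : Continuous ψ) (hg : Continuous g) (hψ1 : ∀ x, ‖ψ x‖ = 1) (hδ0 : 0 ≤ δ) (hδ1 : δ ≤ 1)
    (hgψ : ∀ x, ‖g x - ψ x‖ ≤ δ)
    (hE : ∫ x, ‖g x + a - x‖ ^ 2 ∂sphMeasure ≤ δ ^ 2 * sphMeasure.real Set.univ) :
    ‖a‖ ^ 2 ≤ 432 * δ ^ 2 ∧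
      ∫ x, ‖ψ x - x‖ ^ 2 ∂sphMeasure ≤ 1302 * δ ^ 2 * sphMeasure.real Set.univ := by
  have hm := sphMeasure_univ_pos
  have hx1 (x : Metric.sphere (0 : E3) 1) : ‖(x : E3)‖ = 1 := norm_eq_of_mem_sphere x
  have hGcont : Continuous fun x => ‖g x + a - x‖ ^ 2 := by fun_prop
  have ha5 : ‖a‖ ≤ 5 := by
    have hpt (x) : ‖a‖ ^ 2 ≤ 2 * ‖g x + a - x‖ ^ 2 + 18 := by
      have h : ‖a‖ ≤ ‖g x + a - x‖ + 3 := by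
        have h₁ := norm_sub_le (g x + a - x) (g x - ψ x)
        have h₂ := norm_sub_le (g x + a - x - (g x - ψ x)) (ψ x)
        have h₃ := norm_add_le (g x + a - x - (g x - ψ x) - ψ x) (x : E3)
        have h₄ : g x + a - x - (g x - ψ x) - ψ x + (x : E3) = a := by abel
        rw [h₄] at h₃
        linarith [hgψ x, hψ1 x, hx1 x]
      nlinarith [norm_nonneg a, norm_nonneg (g x + a - x), sq_nonneg (‖g x + a - x‖ - 3)]
    have h := integral_le_of_le_affine continuous_const hGcont hpt
    rw [integral_const, smul_eq_mul] at h
    have h20 : ‖a‖ ^ 2 ≤ 2 * δ ^ 2 + 18 := le_of_mul_le_mul_right (by linarith) hm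
    nlinarith
  have ha : ‖a‖ ^ 2 ≤ 432 * δ ^ 2 := by
    have hpt (x : Metric.sphere (0 : E3) 1) :
        (‖(x : E3) - a‖ - 1) ^ 2 ≤ 2 * ‖g x + a - x‖ ^ 2 + 2 * δ ^ 2 := by
      have h : |‖(x : E3) - a‖ - 1| ≤ ‖g x + a - x‖ + δ := by
        have h₁ := abs_norm_sub_norm_le ((x : E3) - a) (ψ x)
        have h₂ := norm_sub_le (g x - ψ x) (g x + a - x)
        have h₃ : g x - ψ x - (g x + a - x) = (x : E3) - a - ψ x := by abel
        rw [h₃] at h₂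
        rw [hψ1 x] at h₁
        linarith [hgψ x]
      have h' := sq_le_sq' (by linarith [abs_nonneg (‖(x : E3) - a‖ - 1)]) h
      rw [sq_abs] at h'
      nlinarith [sq_nonneg (‖g x + a - x‖ - δ)]
    have h := integral_le_of_le_affine (by fun_prop) hGcont hpt
    have h' := norm_sq_mul_measure_le ha5
    exact le_of_mul_le_mul_right (by linarith) hm
  refine ⟨ha, ?_⟩
  have hpt (x) : ‖ψ x - x‖ ^ 2 ≤ 3 * ‖g x + a - x‖ ^ 2 + 1299 * δ ^ 2 := by
    have h : ‖ψ x - x‖ ≤ ‖g x + a - x‖ + δ + ‖a‖ := by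
      have h₁ := norm_sub_le (g x + a - x) (g x - ψ x)
      have h₂ := norm_sub_le (g x + a - x - (g x - ψ x)) a
      have h₃ : g x + a - x - (g x - ψ x) - a = ψ x - x := by abel
      rw [h₃] at h₂
      linarith [hgψ x]
    have h' := pow_le_pow_left₀ (norm_nonneg _) h 2
    nlinarith [sq_nonneg (‖g x + a - x‖ - δ), sq_nonneg (‖g x + a - x‖ - ‖a‖),
      sq_nonneg (δ - ‖a‖)]
  have h := integral_le_of_le_affine (by fun_prop) hGcont hpt
  linarith

/-- any global minimizer `(a₀, R₀, v₀)` of the normalization functional `ℰ`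
satisfies `|a₀| ≤ C δ∞` and `∫_{S²} |R₀(φ_{v₀}(x)) − x|² dσ ≤ C² δ∞²`, where
`δ∞ = sup_{x ∈ S²} |f(x) − x| ≤ δ₀`. -/
theorem stmt1 :
    ∃ (δ₀ : ℝ) (C : ℝ), 0 < δ₀ ∧ 0 < C ∧
      ∀ (f : E3 → E3) (δinf : ℝ), ContinuousOn f (Metric.sphere (0 : E3) 1) →
        (∀ x ∈ Metric.sphere (0 : E3) 1, ‖f x - x‖ ≤ δinf) →
        δinf ≤ δ₀ →
        ∀ (a₀ : E3) (R₀ : Matrix (Fin 3) (Fin 3) ℝ) (v₀ : E3),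
          R₀ ∈ Matrix.specialOrthogonalGroup (Fin 3) ℝ → ‖v₀‖ < 1 →
          (∀ (a : E3) (R : Matrix (Fin 3) (Fin 3) ℝ) (v : E3),
            R ∈ Matrix.specialOrthogonalGroup (Fin 3) ℝ → ‖v‖ < 1 →
            En f a₀ R₀ v₀ ≤ En f a R v) →
          ‖a₀‖ ≤ C * δinf ∧
          (∫ x : Metric.sphere (0 : E3) 1,
              ‖matAct R₀ (mob v₀ x) - (x : E3)‖ ^ 2 ∂sphMeasure) ≤ C ^ 2 * δinf ^ 2 := by
  have hm := sphMeasure_univ_pos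
  set m := sphMeasure.real Set.univ with hmdef
  refine ⟨1, 1302 * (m + 1), one_pos, by positivity, ?_⟩
  intro f δ hf hfδ hδ1 a R v hR hv hmin
  have hδ0 : 0 ≤ δ := by
    obtain ⟨x, hx⟩ : (Metric.sphere (0 : E3) 1).Nonempty :=
      NormedSpace.sphere_nonempty.2 zero_le_one
    exact (norm_nonneg _).trans (hfδ x hx)
  have hψ : Continuous fun x : Metric.sphere (0 : E3) 1 => matAct R (mob v x) :=
    (continuous_matAct R).comp (continuous_mob hv)
  have hψ1 (x : Metric.sphere (0 : E3) 1) : ‖matAct R (mob v x)‖ = 1 := by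
    rw [norm_matAct hR, norm_mob hv (norm_eq_of_mem_sphere x)]
  have hmem (x : Metric.sphere (0 : E3) 1) :
      matAct R (mob v x) ∈ Metric.sphere (0 : E3) 1 := by simpa using hψ1 x
  obtain ⟨ha, hint⟩ := translation_and_displacement_bound hψ (hf.comp_continuous hψ hmem) hψ1
    hδ0 hδ1 (fun x => hfδ _ (hmem x))
    ((hmin 0 1 0 (one_mem _) (by simp)).trans (En_zero_one_zero_le hf hfδ))
  constructor
  · refine le_of_sq_le_sq ?_ (by positivity)
    nlinarith [mul_nonneg hm.le (sq_nonneg δ), mul_nonneg (sq_nonneg m) (sq_nonneg δ)]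
  · refine hint.trans ?_
    nlinarith [mul_nonneg hm.le (sq_nonneg δ), mul_nonneg (sq_nonneg m) (sq_nonneg δ)]
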